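/- (Proposition 5.3, comparison form.) Let c, c_T > 0, let η* > 0 satisfy (1+1/(4η*))² = η*+1, set K := 1/η* + 1/(4(η*)²), and let t < T satisfy 2cη*(T−t)·(2c_T + K) < 1. Let z̄(s,x) = β̄(s)·|x|²/2 + μ̄(s), where β̄(s) = [ (2c_T + K)⁻¹ − 2cη*(T−s) ]⁻¹ − K and μ̄(s) = c_T·exp[c(4+1/η*)(T−s)] + ∫_s^T [ c(1+1/η*) + (1/2)·tr(a)·β̄(τ) ]·exp[c(4+1/η*)(T−τ)] dτ. Suppose ϖ : [t,T]×ℝⁿ → [0,∞) is continuous, C¹ in s and C² in x on [t,T)×ℝⁿ, and satisfies −∂_s ϖ(s,x) + 𝒜ϖ(s,x) ≤ cη*·|Dϖ(s,x)|² + c(4+1/η*)·ϖ(s,x) + c(1+1/η*)·(1+|x|²) on [t,T)×ℝⁿ, ϖ(T,x) ≤ c_T(1+|x|²), and limsup_{R→∞} sup_{s∈[t,T], |x|≥R} (ϖ(s,x) − z̄(s,x)) ≤ 0. Then ϖ(s,x) ≤ z̄(s,x) for all (s,x) ∈ [t,T]×ℝⁿ. In particular, if ϖ = |DV|²/2 for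 a function V differentiable in x, then |DV(s,x)| ≤ √(2·z̄(s,x)) ≤ C(1+|x|) for a constant C depending only on c, c_T, tr(a), η* and T−t. -/

import Mathlib

open Real MeasureTheory Matrix

noncomputable section

abbrev Euc (n : ℕ) := EuclideanSpace ℝ (Fin n)

/-- Second partial derivative `∂²φ/(∂x_i ∂x_j)(x)`. -/
def secondPartial (n : ℕ) (φ : Euc n → ℝ) (x : Euc n) (i j : Fin n) : ℝ :=
  fderiv ℝ (fun y => fderiv ℝ φ y (EuclideanSpace.single j 1)) x (EuclideanSpace.single i 1)

/-- The operator `𝒜φ(x) = −(1/2)·∑_{i,j} a_{ij}·∂²φ/(∂x_i∂x_j)(x)`. -/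
def opA (n : ℕ) (a : Matrix (Fin n) (Fin n) ℝ) (φ : Euc n → ℝ) (x : Euc n) : ℝ :=
  -(1 / 2) * ∑ i, ∑ j, a i j * secondPartial n φ x i j

theorem deriv_deriv_nonpos_of_isLocalMax {g : ℝ → ℝ} {r : ℝ} (hg : ContinuousAt g r)
    (hmax : IsLocalMax g r) : deriv (deriv g) r ≤ 0 := by
  by_contra! hpos
  have hmin := isLocalMin_of_deriv_deriv_pos hpos hmax.deriv_eq_zero hg
  have hconst : g =ᶠ[nhds r] fun _ => g r := by
    filter_upwards [hmax, hmin] with y h1 h2 using le_antisymm h1 h2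
  have h2 : deriv (deriv g) r = 0 := by
    rw [hconst.deriv.deriv_eq]
    simp
  exact hpos.ne' h2

theorem fderiv_fderiv_apply_self_nonpos {E : Type*} [NormedAddCommGroup E] [NormedSpace ℝ E]
    {φ : E → ℝ} {x : E} (hφ : ContDiff ℝ 2 φ) (hmax : IsLocalMax φ x) (v : E) :
    fderiv ℝ (fderiv ℝ φ) x v v ≤ 0 := by
  have hline : ∀ r : ℝ, HasDerivAt (fun r : ℝ => x + r • v) v r := fun r => by
    simpa using ((hasDerivAt_id r).smul_const v).const_add x
  have hφ' : Differentiable ℝ (fderiv ℝ φ) :=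
    (hφ.fderiv_right (m := 1) (by norm_num)).differentiable (by norm_num)
  have h1 : deriv (fun r : ℝ => φ (x + r • v)) = fun r => fderiv ℝ φ (x + r • v) v := by
    funext r
    exact ((hφ.differentiable (by norm_num) _).hasFDerivAt.comp_hasDerivAt r (hline r)).deriv
  have h2 : deriv (deriv fun r : ℝ => φ (x + r • v)) 0 = fderiv ℝ (fderiv ℝ φ) x v v := by
    rw [h1]
    have h3 : HasDerivAt (fun r : ℝ => fderiv ℝ φ (x + r • v)) (fderiv ℝ (fderiv ℝ φ) x v) 0 :=
      (hφ' x).hasFDerivAt.comp_hasDerivAt_of_eq 0 (hline 0) (by simp)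
    have h4 := (ContinuousLinearMap.apply ℝ ℝ v).hasFDerivAt.comp_hasDerivAt (0 : ℝ) h3
    exact h4.deriv
  rw [← h2]
  have hcont : ContinuousAt (fun r : ℝ => x + r • v) 0 := (hline 0).continuousAt
  refine deriv_deriv_nonpos_of_isLocalMax
    (hφ.continuous.continuousAt.comp hcont) ?_
  have hx : IsLocalMax φ (x + (0 : ℝ) • v) := by simpa using hmax
  exact IsLocalMax.comp_continuous (g := fun r : ℝ => x + r • v) (b := 0) hx hcont

theorem secondPartial_eq_fderiv_fderiv {n : ℕ} {φ : Euc n → ℝ} (hφ : ContDiff ℝ 2 φ) (x : Euc n)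
    (i j : Fin n) : secondPartial n φ x i j =
      fderiv ℝ (fderiv ℝ φ) x (EuclideanSpace.single i 1) (EuclideanSpace.single j 1) := by
  have hφ' : Differentiable ℝ (fderiv ℝ φ) :=
    (hφ.fderiv_right (m := 1) (by norm_num)).differentiable (by norm_num)
  have := ((hφ' x).hasFDerivAt.clm_apply
    (hasFDerivAt_const (EuclideanSpace.single j (1 : ℝ)) x)).fderiv
  rw [secondPartial, this]
  simp

theorem opA_nonneg_of_isLocalMax {n : ℕ} (S : Matrix (Fin n) (Fin n) ℝ) {φ : Euc n → ℝ}
    {x : Euc n} (hφ : ContDiff ℝ 2 φ) (hmax : IsLocalMax φ x) : 0 ≤ opA n (S * Sᵀ) φ x := by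
  set B := fderiv ℝ (fderiv ℝ φ) x with hB
  have hcol : ∀ k, B (∑ i, S i k • EuclideanSpace.single i (1 : ℝ))
      (∑ j, S j k • EuclideanSpace.single j (1 : ℝ)) =
      ∑ i, ∑ j, S i k * S j k * secondPartial n φ x i j := fun k => by
    simp only [secondPartial_eq_fderiv_fderiv hφ, map_sum, map_smul,
      _root_.sum_apply, _root_.smul_apply, smul_eq_mul, Finset.mul_sum,
      ← hB]
    rw [Finset.sum_comm]
    exact Finset.sum_congr rfl fun i _ => Finset.sum_congr rfl fun j _ => by ring
  have hsum : ∑ i, ∑ j, (S * Sᵀ) i j * secondPartial n φ x i j =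
      ∑ k, ∑ i, ∑ j, S i k * S j k * secondPartial n φ x i j := by
    simp only [Matrix.mul_apply, Matrix.transpose_apply, Finset.sum_mul]
    rw [Finset.sum_comm]
    rw [Finset.sum_comm, Finset.sum_comm (s := Finset.univ) (t := Finset.univ)
      (f := fun k i => ∑ j, S i k * S j k * secondPartial n φ x i j)]
    exact Finset.sum_congr rfl fun i _ => Finset.sum_comm
  have : ∑ i, ∑ j, (S * Sᵀ) i j * secondPartial n φ x i j ≤ 0 := by
    rw [hsum]
    refine Finset.sum_nonpos fun k _ => ?_
    rw [← hcol]
    exact fderiv_fderiv_apply_self_nonpos hφ hmax _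
  rw [opA]
  linarith

theorem opA_sub {n : ℕ} (a : Matrix (Fin n) (Fin n) ℝ) {φ ψ : Euc n → ℝ} (x : Euc n)
    (hφ : ContDiff ℝ 2 φ) (hψ : ContDiff ℝ 2 ψ) :
    opA n a (fun y => φ y - ψ y) x = opA n a φ x - opA n a ψ x := by
  have hd : ∀ {χ : Euc n → ℝ}, ContDiff ℝ 2 χ → Differentiable ℝ (fderiv ℝ χ) := fun h =>
    (h.fderiv_right (m := 1) (by norm_num)).differentiable (by norm_num)
  have h1 : fderiv ℝ (fun y => φ y - ψ y) = fun y => fderiv ℝ φ y - fderiv ℝ ψ y := by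
    funext y
    exact fderiv_fun_sub (hφ.differentiable (by norm_num) y) (hψ.differentiable (by norm_num) y)
  have h2 : ∀ i j, secondPartial n (fun y => φ y - ψ y) x i j =
      secondPartial n φ x i j - secondPartial n ψ x i j := fun i j => by
    rw [secondPartial_eq_fderiv_fderiv (hφ.sub hψ), secondPartial_eq_fderiv_fderiv hφ,
      secondPartial_eq_fderiv_fderiv hψ, h1, fderiv_fun_sub (hd hφ x) (hd hψ x)]
    simp
  simp only [opA, h2, mul_sub, Finset.sum_sub_distrib]

theorem hasFDerivAt_quadratic {E : Type*} [NormedAddCommGroup E] [InnerProductSpace ℝ E]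
    (b m : ℝ) (x : E) :
    HasFDerivAt (fun y : E => b * ‖y‖ ^ 2 / 2 + m) (b • innerSL ℝ x) x := by
  have h := (((hasStrictFDerivAt_norm_sq x).hasFDerivAt.const_mul (b / 2)).add_const m)
  have hf : (fun y : E => b * ‖y‖ ^ 2 / 2 + m) = fun y => b / 2 * ‖y‖ ^ 2 + m := by
    funext y; ring
  rw [hf]
  refine h.congr_fderiv ?_
  ext v
  simp
  ring

theorem gradient_quadratic {E : Type*} [NormedAddCommGroup E] [InnerProductSpace ℝ E]
    [CompleteSpace E] (b m : ℝ) (x : E) :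
    gradient (fun y : E => b * ‖y‖ ^ 2 / 2 + m) x = b • x := by
  refine HasGradientAt.gradient ?_
  rw [hasGradientAt_iff_hasFDerivAt]
  refine (hasFDerivAt_quadratic b m x).congr_fderiv ?_
  ext v
  simp

theorem opA_quadratic {n : ℕ} (a : Matrix (Fin n) (Fin n) ℝ) (b m : ℝ) (x : Euc n) :
    opA n a (fun y => b * ‖y‖ ^ 2 / 2 + m) x = -(1 / 2) * (b * a.trace) := by
  have h : ∀ i j : Fin n, secondPartial n (fun y : Euc n => b * ‖y‖ ^ 2 / 2 + m) x i j =
      if i = j then b else 0 := fun i j => by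
    have h1 : (fun y : Euc n => fderiv ℝ (fun y => b * ‖y‖ ^ 2 / 2 + m) y
        (EuclideanSpace.single j 1)) = b • innerSL ℝ (EuclideanSpace.single j (1 : ℝ)) := by
      funext y
      rw [(hasFDerivAt_quadratic b m y).fderiv]
      simp [EuclideanSpace.inner_single_left, EuclideanSpace.inner_single_right]
    rw [secondPartial, h1]
    have h2 := (b • innerSL ℝ (EuclideanSpace.single j (1 : ℝ)) : Euc n →L[ℝ] ℝ).fderiv (x := x)
    erw [h2]
    simp [EuclideanSpace.inner_single_left, eq_comm]
  simp [opA, h, Matrix.trace, Finset.mul_sum, mul_comm]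

/-- The antitonicity of `F` lets the kernel `exp (l (T - τ))` replace the one that solves
`-μ' = l μ + F` exactly. -/
theorem mul_integral_exp_le {F : ℝ → ℝ} {l s T : ℝ} (hl : 0 ≤ l) (hsT : s ≤ T)
    (hF : AntitoneOn F (Set.Icc s T))
    (hint : IntervalIntegrable (fun τ => F τ * exp (l * (T - τ))) volume s T) :
    l * ∫ τ in s..T, F τ * exp (l * (T - τ)) ≤ F s * (exp (l * (T - s)) - 1) := by
  have hprim : ∀ τ ∈ Set.uIcc s T,
      HasDerivAt (fun τ => -exp (l * (T - τ))) (l * exp (l * (T - τ))) τ := fun τ _ => by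
    have := (((hasDerivAt_id τ).const_sub T).const_mul l).exp.fun_neg
    simpa [mul_comm] using this
  have hc : Continuous fun τ => l * exp (l * (T - τ)) := by fun_prop
  have hI := intervalIntegral.integral_eq_sub_of_hasDerivAt hprim (hc.intervalIntegrable s T)
  have hmono := intervalIntegral.integral_mono_on hsT (hint.const_mul l)
    ((hc.intervalIntegrable s T).const_mul (F s)) fun τ hτ => by
      have := hF (Set.left_mem_Icc.2 hsT) hτ hτ.1
      have h0 : 0 ≤ l * exp (l * (T - τ)) := by positivity
      nlinarith [mul_le_mul_of_nonneg_right this h0]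
  rw [intervalIntegral.integral_const_mul, intervalIntegral.integral_const_mul, hI] at hmono
  simpa [sub_eq_add_neg, add_comm] using hmono

theorem maximum_principle_of_critical_points {E : Type*} [NormedAddCommGroup E] [ProperSpace E]
    {w : ℝ → E → ℝ} {t T l : ℝ}
    (hcont : ContinuousOn (fun p : ℝ × E => w p.1 p.2) (Set.Icc t T ×ˢ Set.univ))
    (hdiff : ∀ x, ∀ s ∈ Set.Ico t T, DifferentiableAt ℝ (fun s' => w s' x) s)
    (hterm : ∀ x, w T x ≤ 0)
    (hinf : ∀ ε > (0 : ℝ), ∃ R : ℝ, ∀ s ∈ Set.Icc t T, ∀ x, R ≤ ‖x‖ → w s x ≤ ε)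
    (hcrit : ∀ s ∈ Set.Ico t T, ∀ x, IsLocalMax (w s) x →
      -deriv (fun s' => w s' x) s ≤ l * w s x) :
    ∀ s ∈ Set.Icc t T, ∀ x, w s x ≤ 0 := by
  intro s₀ hs₀ x₀
  by_contra! hpos
  let v : ℝ × E → ℝ := fun p => exp ((l + 1) * p.1) * w p.1 p.2
  have hv₀ : 0 < v (s₀, x₀) := mul_pos (exp_pos _) hpos
  have hvcont : ContinuousOn v (Set.Icc t T ×ˢ Set.univ) :=
    ContinuousOn.mul (by fun_prop) hcont
  obtain ⟨B, hB⟩ : ∃ B, ∀ s ∈ Set.Icc t T, exp ((l + 1) * s) ≤ B := by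
    obtain ⟨B, hB⟩ := (isCompact_Icc (a := t) (b := T)).bddAbove_image
      (f := fun s => exp ((l + 1) * s)) (by fun_prop)
    exact ⟨B, fun s hs => hB (Set.mem_image_of_mem _ hs)⟩
  have hBpos : 0 < B := (exp_pos _).trans_le (hB s₀ hs₀)
  obtain ⟨R, hR⟩ := hinf (v (s₀, x₀) / B) (div_pos hv₀ hBpos)
  have hout : ∀ s ∈ Set.Icc t T, ∀ x, R ≤ ‖x‖ → v (s, x) ≤ v (s₀, x₀) := fun s hs x hx => by
    have h1 := hR s hs x hx
    calc v (s, x) ≤ exp ((l + 1) * s) * (v (s₀, x₀) / B) :=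
          mul_le_mul_of_nonneg_left h1 (exp_pos _).le
      _ ≤ B * (v (s₀, x₀) / B) :=
          mul_le_mul_of_nonneg_right (hB s hs) (div_pos hv₀ hBpos).le
      _ = v (s₀, x₀) := mul_div_cancel₀ _ hBpos.ne'
  have hmem₀ : (s₀, x₀) ∈ Set.Icc t T ×ˢ Metric.closedBall (0 : E) (max R ‖x₀‖) :=
    ⟨hs₀, by simp⟩
  obtain ⟨⟨s₁, x₁⟩, ⟨hs₁, -⟩, hmax⟩ :=
    (isCompact_Icc.prod (isCompact_closedBall (0 : E) (max R ‖x₀‖))).exists_isMaxOn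
      ⟨_, hmem₀⟩ (hvcont.mono (Set.prod_mono subset_rfl (Set.subset_univ _)))
  have hle₀ : v (s₀, x₀) ≤ v (s₁, x₁) := hmax hmem₀
  have hglob : ∀ s ∈ Set.Icc t T, ∀ x, v (s, x) ≤ v (s₁, x₁) := fun s hs x => by
    rcases le_total R ‖x‖ with h | h
    · exact (hout s hs x h).trans hle₀
    · exact hmax ⟨hs, by simpa using Or.inl h⟩
  have hw₁ : 0 < w s₁ x₁ := by
    have : 0 < exp ((l + 1) * s₁) * w s₁ x₁ := hv₀.trans_le hle₀
    exact pos_of_mul_pos_right this (exp_pos _).le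
  have hs₁T : s₁ < T := lt_of_le_of_ne hs₁.2 fun h => by
    rw [h] at hw₁
    exact hw₁.not_ge (hterm x₁)
  have hs₁' : s₁ ∈ Set.Ico t T := ⟨hs₁.1, hs₁T⟩
  have hspace : IsLocalMax (w s₁) x₁ := Filter.Eventually.of_forall fun x =>
    le_of_mul_le_mul_left (hglob s₁ hs₁ x) (exp_pos _)
  have hderiv : HasDerivAt (fun s => v (s, x₁)) (exp ((l + 1) * s₁) * (l + 1) * w s₁ x₁ +
      exp ((l + 1) * s₁) * deriv (fun s' => w s' x₁) s₁) s₁ := by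
    have h1 : HasDerivAt (fun s : ℝ => exp ((l + 1) * s)) (exp ((l + 1) * s₁) * (l + 1)) s₁ := by
      simpa using ((hasDerivAt_id s₁).const_mul (l + 1)).exp
    exact h1.mul (hdiff x₁ s₁ hs₁').hasDerivAt
  have htime : IsLocalMaxOn (fun s => v (s, x₁)) (Set.Icc s₁ T) s₁ :=
    IsMaxOn.localize fun s hs => hglob s ⟨hs₁.1.trans hs.1, hs.2⟩ x₁
  have hcone : T - s₁ ∈ posTangentConeAt (Set.Icc s₁ T) s₁ :=
    sub_mem_posTangentConeAt_of_segment_subset (segment_eq_Icc hs₁T.le).subset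
  have hsign := htime.hasFDerivWithinAt_nonpos hderiv.hasFDerivAt.hasFDerivWithinAt hcone
  simp only [ContinuousLinearMap.toSpanSingleton_apply, smul_eq_mul] at hsign
  have hsign' := nonpos_of_mul_nonpos_right hsign (sub_pos.2 hs₁T)
  have hsum : (l + 1) * w s₁ x₁ + deriv (fun s' => w s' x₁) s₁ ≤ 0 := by
    refine nonpos_of_mul_nonpos_right ?_ (exp_pos ((l + 1) * s₁))
    linarith
  have := hcrit s₁ hs₁' x₁ hspace
  linarith

/-- **Proposition 5.3, comparison form.** If `ϖ ≥ 0` satisfies the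
differential inequality `−∂_s ϖ + 𝒜ϖ ≤ cη*|Dϖ|² + c(4+1/η*)ϖ + c(1+1/η*)(1+|x|²)` with
terminal bound `ϖ(T,x) ≤ c_T(1+|x|²)` and the condition at infinity, then `ϖ ≤ z̄`; in
particular, if `ϖ = |DV|²/2`, then `|DV| ≤ √(2z̄) ≤ C(1+|x|)`. -/
theorem gradient_a_priori_estimate
    (n : ℕ) (hn : 1 ≤ n) (σM : Matrix (Fin n) (Fin n) ℝ) (hσ : IsUnit σM.det)
    (a : Matrix (Fin n) (Fin n) ℝ) (ha : a = σM * σMᵀ)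
    (c cT ηs t T : ℝ) (hc : 0 < c) (hcT : 0 < cT) (hηs : 0 < ηs)
    (hηeq : (1 + 1 / (4 * ηs)) ^ 2 = ηs + 1) (htT : t < T)
    (K : ℝ) (hKdef : K = 1 / ηs + 1 / (4 * ηs ^ 2))
    (hsmall : 2 * c * ηs * (T - t) * (2 * cT + K) < 1)
    -- the majorant z̄
    (βb μb : ℝ → ℝ) (zb : ℝ → Euc n → ℝ)
    (hβb : ∀ s, βb s = ((2 * cT + K)⁻¹ - 2 * c * ηs * (T - s))⁻¹ - K)
    (hμb : ∀ s, μb s = cT * Real.exp (c * (4 + 1 / ηs) * (T - s)) +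
      ∫ τ in s..T,
        (c * (1 + 1 / ηs) + (1 / 2) * a.trace * βb τ) * Real.exp (c * (4 + 1 / ηs) * (T - τ)))
    (hzb : ∀ s x, zb s x = βb s * ‖x‖ ^ 2 / 2 + μb s)
    -- the subsolution ϖ : nonnegative, continuous, C¹ in s and C² in x on [t,T)×ℝⁿ
    (ϖ : ℝ → Euc n → ℝ)
    (hϖ0 : ∀ s ∈ Set.Icc t T, ∀ x : Euc n, 0 ≤ ϖ s x)
    (hϖcont : ContinuousOn (fun p : ℝ × Euc n => ϖ p.1 p.2) (Set.Icc t T ×ˢ Set.univ))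
    (hϖt : ∀ x : Euc n, ∀ s ∈ Set.Ico t T, DifferentiableAt ℝ (fun σ' => ϖ σ' x) s)
    (hϖx : ∀ s ∈ Set.Ico t T, ContDiff ℝ 2 (ϖ s))
    -- the differential inequality
    (hineq : ∀ s ∈ Set.Ico t T, ∀ x : Euc n,
      -(deriv (fun σ' => ϖ σ' x) s) + opA n a (ϖ s) x
        ≤ c * ηs * ‖gradient (ϖ s) x‖ ^ 2 + c * (4 + 1 / ηs) * ϖ s x
          + c * (1 + 1 / ηs) * (1 + ‖x‖ ^ 2))
    (hterm : ∀ x : Euc n, ϖ T x ≤ cT * (1 + ‖x‖ ^ 2))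
    -- condition at infinity
    (hinf : ∀ ε > (0 : ℝ), ∃ R : ℝ, ∀ s ∈ Set.Icc t T, ∀ x : Euc n, R ≤ ‖x‖ →
      ϖ s x - zb s x ≤ ε) :
    -- comparison
    (∀ s ∈ Set.Icc t T, ∀ x : Euc n, ϖ s x ≤ zb s x) ∧
    -- in particular: a linear-growth gradient bound
    (∀ V : ℝ → Euc n → ℝ,
      (∀ s ∈ Set.Icc t T, ∀ x : Euc n, ϖ s x = ‖gradient (V s) x‖ ^ 2 / 2) →
      ∃ C > (0 : ℝ), ∀ s ∈ Set.Icc t T, ∀ x : Euc n,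
        ‖gradient (V s) x‖ ≤ Real.sqrt (2 * zb s x) ∧
        Real.sqrt (2 * zb s x) ≤ C * (1 + ‖x‖)) := by
  set L : ℝ := 2 * cT + K with hL
  set l : ℝ := c * (4 + 1 / ηs) with hl
  set q : ℝ → ℝ := fun s => L⁻¹ - 2 * c * ηs * (T - s) with hq
  set F : ℝ → ℝ := fun s => c * (1 + 1 / ηs) + 1 / 2 * a.trace * βb s with hF
  have hK0 : 0 < K := by rw [hKdef]; positivity
  have hL0 : 0 < L := by positivity
  have hl0 : 0 < l := by positivity
  have htr : 0 ≤ a.trace := by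
    simp only [ha, Matrix.trace, Matrix.diag, Matrix.mul_apply, Matrix.transpose_apply]
    exact Finset.sum_nonneg fun i _ => Finset.sum_nonneg fun j _ => mul_self_nonneg _
  have hK1 : ηs * K = 1 + 1 / ηs / 4 := by rw [hKdef]; field_simp
  have hK2 : ηs * K ^ 2 = 1 + 1 / ηs := by
    have h1 : 1 + 1 / (4 * ηs) = ηs * K := by rw [hK1]; field_simp
    have h2 : ηs * (ηs * K ^ 2) = ηs * (1 + 1 / ηs) := by
      rw [mul_add, mul_one_div_cancel hηs.ne']
      rw [h1] at hηeq
      linarith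
    exact mul_left_cancel₀ hηs.ne' h2
  have hβ : ∀ s, βb s = (q s)⁻¹ - K := hβb
  have hq0 : ∀ s ∈ Set.Icc t T, 0 < q s := fun s hs => by
    have h1 : 2 * c * ηs * (T - s) ≤ 2 * c * ηs * (T - t) :=
      mul_le_mul_of_nonneg_left (by linarith [hs.1]) (by positivity)
    have h2 : 2 * c * ηs * (T - t) < L⁻¹ := by
      rw [← one_div, lt_div_iff₀ hL0]
      exact hsmall
    simp only [hq]
    linarith
  have hβanti : AntitoneOn βb (Set.Icc t T) := fun s hs r hr hsr => by
    rw [hβ, hβ]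
    have : q s ≤ q r := by
      simp only [hq]
      have := mul_le_mul_of_nonneg_left hsr (by positivity : 0 ≤ 2 * c * ηs)
      linarith
    linarith [inv_anti₀ (hq0 s hs) this]
  have hβT : βb T = 2 * cT := by simp [hβ, hq, hL]
  have hβpos : ∀ s ∈ Set.Icc t T, 0 < βb s := fun s hs => by
    have := hβanti hs (Set.right_mem_Icc.2 htT.le) hs.2
    linarith
  have hβderiv : ∀ s ∈ Set.Icc t T, HasDerivAt βb (-(2 * c * ηs) * (βb s + K) ^ 2) s :=
    fun s hs => by
      have h1 : HasDerivAt q (2 * c * ηs) s := by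
        simpa using (((hasDerivAt_id s).const_sub T).const_mul (2 * c * ηs)).const_sub L⁻¹
      have h2 := (h1.fun_inv (hq0 s hs).ne').sub_const K
      rw [show βb = fun s => (q s)⁻¹ - K from funext hβ]
      refine h2.congr_deriv ?_
      have := (hq0 s hs).ne'
      field_simp
      ring
  have hFcont : ∀ s ∈ Set.Icc t T, ContinuousAt F s := fun s hs =>
    (continuousAt_const.mul (hβderiv s hs).continuousAt).const_add _
  have hFanti : AntitoneOn F (Set.Icc t T) := fun s hs r hr hsr => by
    have := mul_le_mul_of_nonneg_left (hβanti hs hr hsr) (by positivity : 0 ≤ 1 / 2 * a.trace)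
    simp only [hF]
    linarith
  have hGcont : ∀ s ∈ Set.Icc t T, ContinuousAt (fun τ => F τ * exp (l * (T - τ))) s :=
    fun s hs => (hFcont s hs).mul (by fun_prop)
  have hGmeas : Measurable fun τ => F τ * exp (l * (T - τ)) := by
    simp only [hF, hβ, hq]
    fun_prop
  have hGint : ∀ s ∈ Set.Icc t T,
      IntervalIntegrable (fun τ => F τ * exp (l * (T - τ))) volume s T := fun s hs => by
    refine ContinuousOn.intervalIntegrable fun τ hτ => ?_
    rw [Set.uIcc_of_le hs.2] at hτ
    exact (hGcont τ ⟨hs.1.trans hτ.1, hτ.2⟩).continuousWithinAt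
  have hμ : ∀ s, μb s = cT * exp (l * (T - s)) + ∫ τ in s..T, F τ * exp (l * (T - τ)) := hμb
  have hμderiv : ∀ s ∈ Set.Icc t T,
      HasDerivAt μb (-(l * cT * exp (l * (T - s))) - F s * exp (l * (T - s))) s := fun s hs => by
    have h1 : HasDerivAt (fun s => cT * exp (l * (T - s))) (cT * (exp (l * (T - s)) * (-l))) s := by
      simpa using ((((hasDerivAt_id s).const_sub T).const_mul l).exp).const_mul cT
    have h2 := intervalIntegral.integral_hasDerivAt_left (hGint s hs)
      hGmeas.stronglyMeasurable.stronglyMeasurableAtFilter (hGcont s hs)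
    rw [show μb = fun s => cT * exp (l * (T - s)) + ∫ τ in s..T, F τ * exp (l * (T - τ)) from
      funext hμ]
    exact (h1.fun_add h2).congr_deriv (by ring)
  have hβcont : ContinuousOn βb (Set.Icc t T) := fun s hs =>
    (hβderiv s hs).continuousAt.continuousWithinAt
  have hμcont : ContinuousOn μb (Set.Icc t T) := fun s hs =>
    (hμderiv s hs).continuousAt.continuousWithinAt
  have hμsuper : ∀ s ∈ Set.Icc t T, l * μb s + F s ≤
      l * cT * exp (l * (T - s)) + F s * exp (l * (T - s)) := fun s hs => by
    have := mul_integral_exp_le hl0.le hs.2 (hFanti.mono (Set.Icc_subset_Icc_left hs.1))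
      (hGint s hs)
    rw [hμ s]
    linarith
  have hz : ∀ s, zb s = fun x => βb s * ‖x‖ ^ 2 / 2 + μb s := fun s => funext (hzb s)
  have hz2 : ∀ s, ContDiff ℝ 2 (zb s) := fun s => by
    rw [hz]
    exact ((contDiff_const.mul (contDiff_norm_sq ℝ)).div_const _).add contDiff_const
  have hzderiv : ∀ x, ∀ s ∈ Set.Icc t T, HasDerivAt (fun s' => zb s' x)
      (-(2 * c * ηs) * (βb s + K) ^ 2 * ‖x‖ ^ 2 / 2 +
        (-(l * cT * exp (l * (T - s))) - F s * exp (l * (T - s)))) s := fun x s hs => by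
    rw [show (fun s' => zb s' x) = fun s' => βb s' * ‖x‖ ^ 2 / 2 + μb s' from
      funext fun s' => hzb s' x]
    exact (((hβderiv s hs).mul_const _).div_const _).fun_add (hμderiv s hs)
  have hmain : ∀ s ∈ Set.Icc t T, ∀ x, ϖ s x - zb s x ≤ 0 := by
    refine maximum_principle_of_critical_points (w := fun s x => ϖ s x - zb s x) (l := l)
      ?_ ?_ ?_ hinf ?_
    · refine hϖcont.sub ?_
      simp only [hzb]
      have hfst : Set.MapsTo (Prod.fst : ℝ × Euc n → ℝ) (Set.Icc t T ×ˢ Set.univ)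
        (Set.Icc t T) := fun p hp => hp.1
      have h1 := hβcont.comp continuousOn_fst hfst
      have h2 := hμcont.comp continuousOn_fst hfst
      have h3 : ContinuousOn (fun p : ℝ × Euc n => ‖p.2‖ ^ 2) (Set.Icc t T ×ˢ Set.univ) := by
        fun_prop
      exact ((h1.mul h3).div_const 2).add h2
    · exact fun x s hs => (hϖt x s hs).fun_sub
        (hzderiv x s (Set.Ico_subset_Icc_self hs)).differentiableAt
    · intro x
      have := hterm x
      have hμT : μb T = cT := by simp [hμ]
      rw [hzb, hβT, hμT]
      linarith
    · intro s hs x hmax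
      have hs' := Set.Ico_subset_Icc_self hs
      have hgrad : gradient (ϖ s) x = βb s • x := by
        have h0 := hmax.fderiv_eq_zero
        rw [fderiv_fun_sub ((hϖx s hs).differentiable (by norm_num) x)
          ((hz2 s).differentiable (by norm_num) x), sub_eq_zero] at h0
        rw [gradient, h0, ← gradient, hz, gradient_quadratic]
      have hA : 0 ≤ opA n a (ϖ s) x + 1 / 2 * (βb s * a.trace) := by
        have h0 := opA_nonneg_of_isLocalMax σM ((hϖx s hs).sub (hz2 s)) hmax
        rw [← ha, opA_sub a x (hϖx s hs) (hz2 s), hz, opA_quadratic] at h0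
        linarith
      have hd : deriv (fun s' => ϖ s' x - zb s' x) s = _ :=
        ((hϖt x s hs).hasDerivAt.fun_sub (hzderiv x s hs')).deriv
      have hsub := hineq s hs x
      have hsup := hμsuper s hs'
      have hnorm : ‖gradient (ϖ s) x‖ ^ 2 = βb s ^ 2 * ‖x‖ ^ 2 := by
        rw [hgrad, norm_smul, mul_pow, Real.norm_eq_abs, sq_abs]
      have hriccati : c * ηs * (βb s + K) ^ 2 =
          c * ηs * βb s ^ 2 + l * βb s / 2 + c * (1 + 1 / ηs) := by
        rw [hl]
        linear_combination 2 * c * βb s * hK1 + c * hK2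
      have hriccati' := congrArg (· * ‖x‖ ^ 2) hriccati
      rw [hnorm] at hsub
      rw [hd, hzb]
      simp only [hF] at hsup hriccati' ⊢
      linarith
  refine ⟨fun s hs x => sub_nonpos.1 (hmain s hs x), fun V hV => ?_⟩
  obtain ⟨M, hM⟩ : ∃ M, ∀ s ∈ Set.Icc t T, μb s ≤ M := by
    obtain ⟨M, hM⟩ := isCompact_Icc.bddAbove_image hμcont
    exact ⟨M, fun s hs => hM (Set.mem_image_of_mem _ hs)⟩
  have hβt := hβpos t (Set.left_mem_Icc.2 htT.le)
  have hC : 0 < βb t + 2 * |M| := by positivity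
  refine ⟨√(βb t + 2 * |M|), Real.sqrt_pos.2 hC, fun s hs x => ⟨?_, ?_⟩⟩
  · refine Real.le_sqrt_of_sq_le ?_
    have h1 := hmain s hs x
    rw [hV s hs x] at h1
    linarith
  · have hx := norm_nonneg x
    refine Real.sqrt_le_iff.2 ⟨by positivity, ?_⟩
    rw [mul_pow, Real.sq_sqrt hC.le, hzb]
    have h1 := hβanti (Set.left_mem_Icc.2 htT.le) hs hs.1
    have h2 := (hM s hs).trans (le_abs_self M)
    have h3 : βb s * ‖x‖ ^ 2 ≤ βb t * (1 + ‖x‖) ^ 2 :=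
      mul_le_mul h1 (by nlinarith) (sq_nonneg _) hβt.le
    have h4 : |M| * 1 ≤ |M| * (1 + ‖x‖) ^ 2 :=
      mul_le_mul_of_nonneg_left (by nlinarith) (abs_nonneg M)
    linarith

end
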